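/- Let I be a square-free monomial ideal of R = K[x_1,…,x_r]. Then for every integer n ≥ 1 and every i ≥ 0, the a_i-invariant satisfies a_i(R/I^{(n)}) ≤ δ(I)·(n − 1). -/

import Mathlib

open MvPolynomial Finset Filter

noncomputable section

/-- A family of potential faces (subsets of the vertex set `ι`). -/
abbrev FaceSet (ι : Type*) := Set (Finset ι)

/-- A face set is a simplicial complex if it is closed under taking subsets. -/
def IsSimplicialComplex {ι : Type*} (Δ : FaceSet ι) : Prop :=
  ∀ σ ∈ Δ, ∀ τ : Finset ι, τ ⊆ σ → τ ∈ Δ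

/-- The facets (maximal faces) of a face set. -/
def facets {ι : Type*} (Δ : FaceSet ι) : FaceSet ι :=
  {σ | σ ∈ Δ ∧ ∀ τ ∈ Δ, σ ⊆ τ → σ = τ}

/-- The Stanley–Reisner ideal of a simplicial complex: it is generated by the
square-free monomials corresponding to non-faces. -/
def srIdeal (K : Type*) [Field K] {ι : Type*} (Δ : FaceSet ι) :
    Ideal (MvPolynomial ι K) :=
  Ideal.span {p | ∃ τ : Finset ι, τ ∉ Δ ∧ p = ∏ i ∈ τ, X i}

/-- The `n`-th symbolic power `I^{(n)} = ⋂_{p ∈ Min(I)} (Iⁿ R_p ∩ R)`. -/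
def symbolicPower {R : Type*} [CommRing R] (I : Ideal R) (n : ℕ) : Ideal R :=
  ⨅ (p : Ideal R) (hp : p ∈ I.minimalPrimes),
    letI : p.IsPrime := hp.1.1
    (Ideal.map (algebraMap R (Localization.AtPrime p)) (I ^ n)).comap
      (algebraMap R (Localization.AtPrime p))

/-- The simplicial boundary operator on the space of chains (finitely supported
`K`-valued functions on finite subsets of `ι`), using the orientation coming
from the linear order of `ι`; a set of cardinality `d` is viewed as a
`(d-1)`-dimensional simplex, the empty set accounting for the augmentation. -/
def bdry (K : Type*) [Field K] {ι : Type*} [LinearOrder ι] :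
    (Finset ι →₀ K) →ₗ[K] (Finset ι →₀ K) :=
  Finsupp.lsum K fun σ => LinearMap.toSpanSingleton K _
    (∑ v ∈ σ, ((-1 : K) ^ (σ.filter fun w => w < v).card) • Finsupp.single (σ.erase v) (1 : K))

/-- The subspace of chains supported on the faces of `Δ` of cardinality `d`. -/
def cardFaces (K : Type*) [Field K] {ι : Type*} (Δ : FaceSet ι) (d : ℕ) :
    Submodule K (Finset ι →₀ K) :=
  Submodule.span K {f | ∃ σ ∈ Δ, σ.card = d ∧ f = Finsupp.single σ (1 : K)}

/-- `H̃ⱼ(Δ; K) ≠ 0`: there is a cycle of cardinality-degree `j + 1` which is not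
a boundary of a chain of `Δ`. -/
def HasNontrivialReducedHomology (K : Type*) [Field K] {ι : Type*} [LinearOrder ι]
    (Δ : FaceSet ι) (j : ℤ) : Prop :=
  ∃ d : ℕ, (d : ℤ) = j + 1 ∧
    ∃ z ∈ cardFaces K Δ d, bdry K z = 0 ∧ z ∉ ⇑(bdry K) '' ↑(cardFaces K Δ (d + 1))

/-- `G_α = {i : α_i < 0}`. -/
def negSupport {ι : Type*} [Fintype ι] (α : ι → ℤ) : Finset ι :=
  Finset.univ.filter fun i => α i < 0

/-- The degree complex `Δ_α(I) = {F ⊆ [r] \ G_α : x^α ∉ I·R_F}` of Takayama, where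
`x^α ∈ I·R_F` is expressed by saturation: `x^{α⁺}·(∏_{i ∈ F ∪ G_α} x_i)^m ∈ I` for some `m`. -/
def degreeComplex (K : Type*) [Field K] {ι : Type*} [Fintype ι] [LinearOrder ι]
    (I : Ideal (MvPolynomial ι K)) (α : ι → ℤ) : FaceSet ι :=
  {F | (∀ i ∈ F, 0 ≤ α i) ∧
    ¬∃ m : ℕ,
      monomial (Finsupp.equivFunOnFinite.symm fun i => (α i).toNat) (1 : K) *
        (∏ i ∈ F ∪ negSupport α, X i) ^ m ∈ I}

/-- Nonvanishing of the graded piece `H_𝔪^i(R/I)_α` of local cohomology of a monomial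
quotient, expressed via Takayama's formula
`dim_K H_𝔪^i(R/I)_α = dim_K H̃_{i-|G_α|-1}(Δ_α(I); K)`. -/
def lcNonzero (K : Type*) [Field K] {ι : Type*} [Fintype ι] [LinearOrder ι]
    (I : Ideal (MvPolynomial ι K)) (i : ℕ) (α : ι → ℤ) : Prop :=
  HasNontrivialReducedHomology K (degreeComplex K I α) ((i : ℤ) - (negSupport α).card - 1)

/-- The `a_i`-invariant `a_i(R/I) = max{t : H_𝔪^i(R/I)_t ≠ 0}` of a monomial quotient
(`H_𝔪^i(R/I)_t = ⊕_{|α| = t} H_𝔪^i(R/I)_α`). -/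
def aInv (K : Type*) [Field K] {ι : Type*} [Fintype ι] [LinearOrder ι]
    (I : Ideal (MvPolynomial ι K)) (i : ℕ) : ℤ :=
  sSup {z : ℤ | ∃ α : ι → ℤ, lcNonzero K I i α ∧ z = ∑ j, α j}

/-- The Castelnuovo–Mumford regularity `reg(R/I) = max_i (a_i(R/I) + i)` of a
monomial quotient. -/
def regQuot (K : Type*) [Field K] {ι : Type*} [Fintype ι] [LinearOrder ι]
    (I : Ideal (MvPolynomial ι K)) : ℤ :=
  sSup {z : ℤ | ∃ (i : ℕ) (α : ι → ℤ), lcNonzero K I i α ∧ z = (∑ j, α j) + i}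

/-- The Castelnuovo–Mumford regularity of a (monomial) ideal: `reg(I) = reg(R/I) + 1`. -/
def reg (K : Type*) [Field K] {ι : Type*} [Fintype ι] [LinearOrder ι]
    (I : Ideal (MvPolynomial ι K)) : ℤ :=
  regQuot K I + 1

/-- The depth `min{i : H_𝔪^i(R/I) ≠ 0}` of a monomial quotient. -/
def depthQuot (K : Type*) [Field K] {ι : Type*} [Fintype ι] [LinearOrder ι]
    (I : Ideal (MvPolynomial ι K)) : ℕ :=
  sInf {i : ℕ | ∃ α : ι → ℤ, lcNonzero K I i α}

/-- The projective dimension `pd(R/I) = r - depth(R/I)` (Auslander–Buchsbaum). -/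
def pdQuot (K : Type*) [Field K] {ι : Type*} [Fintype ι] [LinearOrder ι]
    (I : Ideal (MvPolynomial ι K)) : ℤ :=
  (Fintype.card ι : ℤ) - depthQuot K I

end

/-- The prime ideal generated by the variables outside `H`. -/
noncomputable def facePrime (K : Type*) [Field K] {ι : Type*} (H : Finset ι) :
    Ideal (MvPolynomial ι K) :=
  Ideal.span (X '' {i | i ∉ H})

open Classical in
/-- The substitution setting the variables outside `H` to zero. -/
noncomputable def faceRestrict (K : Type*) [Field K] {ι : Type*} (H : Finset ι) :
    MvPolynomial ι K →ₐ[K] MvPolynomial ι K :=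
  aeval fun i => if i ∈ H then X i else 0

theorem mem_facePrime_iff {K : Type*} [Field K] {ι : Type*} (H : Finset ι)
    (p : MvPolynomial ι K) : p ∈ facePrime K H ↔ faceRestrict K H p = 0 := by
  constructor
  · intro hp
    have h : facePrime K H ≤ RingHom.ker (faceRestrict K H) := by
      rw [facePrime, Ideal.span_le]
      rintro _ ⟨i, hi, rfl⟩
      simpa [RingHom.mem_ker, faceRestrict] using hi
    exact h hp
  · intro hp
    have h : (Ideal.Quotient.mkₐ K (facePrime K H)).comp (faceRestrict K H) =
        Ideal.Quotient.mkₐ K (facePrime K H) := by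
      ext i
      by_cases hi : i ∈ H
      · simp [faceRestrict, hi]
      · have : (X i : MvPolynomial ι K) ∈ facePrime K H :=
          Ideal.subset_span ⟨i, hi, rfl⟩
        simpa [faceRestrict, hi] using (Ideal.Quotient.eq_zero_iff_mem.mpr this).symm
    have h' := DFunLike.congr_fun h p
    rw [AlgHom.comp_apply, hp, map_zero] at h'
    exact Ideal.Quotient.eq_zero_iff_mem.mp h'.symm

theorem X_mem_facePrime_iff {K : Type*} [Field K] {ι : Type*} (H : Finset ι) (i : ι) :
    (X i : MvPolynomial ι K) ∈ facePrime K H ↔ i ∉ H := by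
  rw [mem_facePrime_iff]
  by_cases hi : i ∈ H <;> simp [faceRestrict, hi, X_ne_zero]

theorem facePrime_isPrime (K : Type*) [Field K] {ι : Type*} (H : Finset ι) :
    (facePrime K H).IsPrime := by
  have : facePrime K H = RingHom.ker (faceRestrict K H) := by
    ext p; rw [mem_facePrime_iff, RingHom.mem_ker]
  rw [this]
  exact RingHom.ker_isPrime _

theorem facePrime_le_facePrime_iff (K : Type*) [Field K] {ι : Type*} (F H : Finset ι) :
    facePrime K F ≤ facePrime K H ↔ H ⊆ F := by
  constructor
  · intro h i hi
    by_contra hF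
    exact (X_mem_facePrime_iff H i).mp (h ((X_mem_facePrime_iff F i).mpr hF)) hi
  · intro h
    exact Ideal.span_mono (Set.image_mono fun i hi hH => hi (h hH))

theorem srIdeal_le_facePrime (K : Type*) [Field K] {ι : Type*} {Δ : FaceSet ι}
    (hΔ : IsSimplicialComplex Δ) {H : Finset ι} (hH : H ∈ Δ) :
    srIdeal K Δ ≤ facePrime K H := by
  rw [srIdeal, Ideal.span_le]
  rintro _ ⟨τ, hτ, rfl⟩
  obtain ⟨i, hi, hiH⟩ : ∃ i ∈ τ, i ∉ H := by
    by_contra! h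
    exact hτ (hΔ H hH τ h)
  exact (facePrime K H).mem_of_dvd (Finset.dvd_prod_of_mem _ hi)
    ((X_mem_facePrime_iff H i).mpr hiH)

theorem exists_facePrime_le (K : Type*) [Field K] {ι : Type*} [Fintype ι] {Δ : FaceSet ι}
    {p : Ideal (MvPolynomial ι K)} (hp : p.IsPrime) (h : srIdeal K Δ ≤ p) :
    ∃ H ∈ Δ, facePrime K H ≤ p := by
  classical
  refine ⟨Finset.univ.filter fun i => X i ∉ p, ?_, ?_⟩
  · by_contra hH
    have := h (Ideal.subset_span ⟨_, hH, rfl⟩)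
    obtain ⟨i, hi, hip⟩ := hp.prod_mem_iff.mp this
    exact (Finset.mem_filter.mp hi).2 hip
  · rw [facePrime, Ideal.span_le]
    rintro _ ⟨i, hi, rfl⟩
    simpa using hi

theorem mem_minimalPrimes_srIdeal_iff (K : Type*) [Field K] {ι : Type*} [Fintype ι]
    {Δ : FaceSet ι} (hΔ : IsSimplicialComplex Δ) (p : Ideal (MvPolynomial ι K)) :
    p ∈ (srIdeal K Δ).minimalPrimes ↔ ∃ H ∈ facets Δ, p = facePrime K H := by
  constructor
  · intro hp
    obtain ⟨H, hH, hle⟩ := exists_facePrime_le K hp.1.1 hp.1.2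
    have hpH := le_antisymm (hp.2 ⟨facePrime_isPrime K H, srIdeal_le_facePrime K hΔ hH⟩ hle) hle
    refine ⟨H, ⟨hH, fun τ hτ hHτ => ?_⟩, hpH⟩
    have hτH := hp.2 ⟨facePrime_isPrime K τ, srIdeal_le_facePrime K hΔ hτ⟩
      (hpH ▸ (facePrime_le_facePrime_iff K τ H).mpr hHτ)
    rw [hpH, facePrime_le_facePrime_iff] at hτH
    exact hHτ.antisymm hτH
  · rintro ⟨H, hH, rfl⟩
    refine ⟨⟨facePrime_isPrime K H, srIdeal_le_facePrime K hΔ hH.1⟩, fun q hq hqH => ?_⟩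
    obtain ⟨F, hF, hle⟩ := exists_facePrime_le K hq.1 hq.2
    rwa [hH.2 F hF ((facePrime_le_facePrime_iff K F H).mp (hle.trans hqH))]

theorem le_sum_of_mul_monomial_mem_pow {K : Type*} [Field K] {ι : Type*} [Fintype ι]
    [DecidableEq ι] (H : Finset ι) (n : ℕ) (a : ι →₀ ℕ) (s : MvPolynomial ι K)
    (hs : s ∉ facePrime K H) (h : s * monomial a 1 ∈ facePrime K H ^ n) :
    n ≤ ∑ i ∈ Hᶜ, a i := by
  let φ : MvPolynomial ι K →ₐ[K] Polynomial (MvPolynomial ι K) :=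
    aeval fun i => Polynomial.X ^ (if i ∈ H then 0 else 1) * Polynomial.C (X i)
  have hφ : facePrime K H ^ n ≤ (Ideal.span {Polynomial.X} ^ n).comap φ := by
    refine (Ideal.pow_right_mono ?_ n).trans (Ideal.le_comap_pow _ n)
    rw [facePrime, Ideal.span_le]
    rintro _ ⟨i, hi, rfl⟩
    have hi' : i ∉ H := hi
    simp [φ, hi', Ideal.mem_span_singleton]
  have hφa : φ (monomial a 1) = Polynomial.X ^ (∑ i ∈ Hᶜ, a i) * Polynomial.C (monomial a 1) := by
    have hsum : ∑ i, (if i ∈ H then 0 else 1) * a i = ∑ i ∈ Hᶜ, a i := by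
      simp [Finset.compl_eq_univ_sdiff, ← Finset.filter_notMem_eq_sdiff, Finset.sum_filter]
    rw [aeval_monomial, Finsupp.prod_fintype _ _ (by simp)]
    simp_rw [mul_pow, Finset.prod_mul_distrib, ← pow_mul, Finset.prod_pow_eq_pow_sum, hsum]
    rw [MvPolynomial.monomial_eq, Finsupp.prod_fintype _ _ (by simp)]
    simp
  have hφs : ¬ Polynomial.X ∣ φ s := by
    rw [Polynomial.X_dvd_iff]
    have : ((Polynomial.constantCoeff : Polynomial (MvPolynomial ι K) →+* _).comp
        (φ : MvPolynomial ι K →+* _)) = (faceRestrict K H : MvPolynomial ι K →+* _) := by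
      ext i : 2
      · simp [φ]
      · by_cases hi : i ∈ H <;> simp [φ, faceRestrict, hi]
    intro h0
    exact hs ((mem_facePrime_iff H s).mpr ((RingHom.congr_fun this s).symm.trans h0))
  by_contra! hlt
  have hdvd := hφ h
  rw [Ideal.mem_comap, Ideal.span_singleton_pow, Ideal.mem_span_singleton, map_mul, hφa,
    mul_left_comm] at hdvd
  have h1 := (pow_dvd_pow Polynomial.X (Nat.succ_le_of_lt hlt)).trans hdvd
  rw [pow_succ] at h1
  have h2 := (mul_dvd_mul_iff_left (pow_ne_zero _ Polynomial.X_ne_zero)).mp h1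
  rcases Polynomial.prime_X.dvd_or_dvd h2 with h3 | h3
  · exact hφs h3
  · rw [Polynomial.X_dvd_iff, Polynomial.coeff_C_zero] at h3
    simp at h3

theorem exists_mul_monomial_mem_srIdeal_pow {K : Type*} [Field K] {ι : Type*} [Fintype ι]
    [DecidableEq ι] {Δ : FaceSet ι} {H : Finset ι} (hH : H ∈ facets Δ) (n : ℕ) (a : ι →₀ ℕ)
    (h : n ≤ ∑ i ∈ Hᶜ, a i) :
    ∃ s ∉ facePrime K H, s * monomial a 1 ∈ srIdeal K Δ ^ n := by
  have := facePrime_isPrime K H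
  set s : MvPolynomial ι K := ∏ i ∈ H, X i with hs
  refine ⟨s ^ (∑ i ∈ Hᶜ, a i), ?_, Ideal.pow_le_pow_right h ?_⟩
  · intro hmem
    obtain ⟨i, hi, hiH⟩ := this.prod_mem_iff.mp (this.mem_of_pow_mem _ hmem)
    exact (X_mem_facePrime_iff H i).mp hiH hi
  · have hX : ∀ i ∈ Hᶜ, s * X i ∈ srIdeal K Δ := by
      intro i hi
      rw [Finset.mem_compl] at hi
      refine Ideal.subset_span ⟨insert i H, fun hΔ => hi ?_, ?_⟩
      · rw [hH.2 _ hΔ (Finset.subset_insert i H)]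
        exact Finset.mem_insert_self i H
      · rw [Finset.prod_insert hi, mul_comm]
    have hprod : ∏ i ∈ Hᶜ, (s * X i) ^ a i ∈ srIdeal K Δ ^ (∑ i ∈ Hᶜ, a i) := by
      rw [← Finset.prod_pow_eq_pow_sum]
      exact Ideal.prod_mem_prod fun i hi => Ideal.pow_mem_pow (hX i hi) _
    simp_rw [mul_pow, Finset.prod_mul_distrib, Finset.prod_pow_eq_pow_sum] at hprod
    have hmon : (monomial a 1 : MvPolynomial ι K) =
        (∏ i ∈ H, X i ^ a i) * ∏ i ∈ Hᶜ, X i ^ a i := by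
      rw [MvPolynomial.monomial_eq, Finsupp.prod_fintype _ _ (by simp), Finset.prod_mul_prod_compl]
      simp
    rw [hmon, mul_left_comm]
    exact Ideal.mul_mem_left _ _ hprod

theorem monomial_mem_symbolicPower_srIdeal_iff {K : Type*} [Field K] {ι : Type*} [Fintype ι]
    [DecidableEq ι] {Δ : FaceSet ι} (hΔ : IsSimplicialComplex Δ) (n : ℕ) (a : ι →₀ ℕ) :
    monomial a 1 ∈ symbolicPower (srIdeal K Δ) n ↔ ∀ H ∈ facets Δ, n ≤ ∑ i ∈ Hᶜ, a i := by
  simp only [symbolicPower, Submodule.mem_iInf]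
  constructor
  · intro h H hH
    have hmin := (mem_minimalPrimes_srIdeal_iff K hΔ _).mpr ⟨H, hH, rfl⟩
    have hprime := facePrime_isPrime K H
    have hmem := h _ hmin
    rw [Ideal.mem_comap, IsLocalization.algebraMap_mem_map_algebraMap_iff
      (facePrime K H).primeCompl] at hmem
    obtain ⟨s, hs, hsa⟩ := hmem
    exact le_sum_of_mul_monomial_mem_pow H n a s hs
      (Ideal.pow_right_mono (srIdeal_le_facePrime K hΔ hH.1) n hsa)
  · intro h p hp
    obtain ⟨H, hH, rfl⟩ := (mem_minimalPrimes_srIdeal_iff K hΔ p).mp hp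
    have hprime := facePrime_isPrime K H
    rw [Ideal.mem_comap, IsLocalization.algebraMap_mem_map_algebraMap_iff
      (facePrime K H).primeCompl]
    exact exists_mul_monomial_mem_srIdeal_pow hH n a (h H hH)

theorem mem_degreeComplex_symbolicPower_iff {K : Type*} [Field K] {ι : Type*} [Fintype ι]
    [LinearOrder ι] {Δ : FaceSet ι} (hΔ : IsSimplicialComplex Δ) (n : ℕ) (α : ι → ℤ)
    (F : Finset ι) :
    F ∈ degreeComplex K (symbolicPower (srIdeal K Δ) n) α ↔ (∀ i ∈ F, 0 ≤ α i) ∧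
      ∃ H ∈ facets Δ, F ∪ negSupport α ⊆ H ∧ ∑ i ∈ Hᶜ, (α i).toNat < n := by
  set U := F ∪ negSupport α with hU
  have hmon (m : ℕ) :
      (monomial (Finsupp.equivFunOnFinite.symm fun i => (α i).toNat) (1 : K) *
        (∏ i ∈ U, X i) ^ m : MvPolynomial ι K) =
      monomial (Finsupp.equivFunOnFinite.symm fun i => (α i).toNat + if i ∈ U then m else 0) 1 := by
    rw [MvPolynomial.monomial_eq, MvPolynomial.monomial_eq, Finsupp.prod_fintype _ _ (by simp),
      Finsupp.prod_fintype _ _ (by simp)]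
    simp_rw [Finsupp.equivFunOnFinite_symm_apply_apply, pow_add, Finset.prod_mul_distrib,
      pow_ite, pow_zero, Finset.prod_ite_mem, Finset.univ_inter, Finset.prod_pow, map_one, one_mul]
  simp only [degreeComplex, Set.mem_ofPred_eq, ← hU, hmon,
    monomial_mem_symbolicPower_srIdeal_iff hΔ, Finsupp.equivFunOnFinite_symm_apply_apply]
  refine and_congr_right fun _ => ?_
  constructor
  · intro h
    by_contra! hcon
    refine h ⟨n, fun H hH => ?_⟩
    by_cases hUH : U ⊆ H
    · exact (hcon H hH hUH).trans (Finset.sum_le_sum fun i _ => Nat.le_add_right _ _)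
    · obtain ⟨i, hiU, hiH⟩ := Finset.not_subset.mp hUH
      refine le_trans ?_ (Finset.single_le_sum (fun _ _ => Nat.zero_le _)
        (Finset.mem_compl.mpr hiH))
      simp [hiU]
  · rintro ⟨H, hH, hUH, hlt⟩ ⟨m, hm⟩
    refine (hm H hH).not_gt ?_
    rwa [Finset.sum_congr rfl fun i hi => by
      rw [if_neg fun hiU => Finset.mem_compl.mp hi (hUH hiU), add_zero]]

theorem bdry_single (K : Type*) [Field K] {ι : Type*} [LinearOrder ι] (σ : Finset ι) :
    bdry K (Finsupp.single σ 1) =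
      ∑ v ∈ σ, ((-1 : K) ^ (σ.filter fun w => w < v).card) • Finsupp.single (σ.erase v) (1 : K) := by
  simp [bdry]

/-- The cone operator with apex `v` on simplicial chains. -/
noncomputable def coneOp (K : Type*) [Field K] {ι : Type*} [LinearOrder ι] (v : ι) :
    (Finset ι →₀ K) →ₗ[K] (Finset ι →₀ K) :=
  Finsupp.lsum K fun σ => LinearMap.toSpanSingleton K _
    (if v ∈ σ then 0
      else ((-1 : K) ^ (σ.filter fun w => w < v).card) • Finsupp.single (insert v σ) (1 : K))

theorem coneOp_single (K : Type*) [Field K] {ι : Type*} [LinearOrder ι] (v : ι) (σ : Finset ι) :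
    coneOp K v (Finsupp.single σ 1) = if v ∈ σ then 0
      else ((-1 : K) ^ (σ.filter fun w => w < v).card) • Finsupp.single (insert v σ) (1 : K) := by
  simp [coneOp]

theorem bdry_coneOp_single_add (K : Type*) [Field K] {ι : Type*} [LinearOrder ι] (v : ι)
    (σ : Finset ι) :
    bdry K (coneOp K v (Finsupp.single σ 1)) + coneOp K v (bdry K (Finsupp.single σ 1)) =
      Finsupp.single σ 1 := by
  by_cases hv : v ∈ σ
  · rw [coneOp_single, if_pos hv, map_zero, zero_add, bdry_single, map_sum,
      Finset.sum_eq_single_of_mem v hv]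
    · have hfilter : ((σ.erase v).filter fun w => w < v) = σ.filter fun w => w < v := by
        ext w; simp only [Finset.mem_filter, Finset.mem_erase]; grind
      rw [map_smul, coneOp_single, if_neg (Finset.notMem_erase v σ), hfilter, smul_smul,
        ← mul_pow, Finset.insert_erase hv]
      simp
    · intro w _ hwv
      rw [map_smul, coneOp_single, if_pos (Finset.mem_erase.mpr ⟨hwv.symm, hv⟩), smul_zero]
  · have hfilter : ((insert v σ).filter fun w => w < v) = σ.filter fun w => w < v := by
      ext w; simp only [Finset.mem_filter, Finset.mem_insert]; grind
    rw [coneOp_single, if_neg hv, map_smul, bdry_single, Finset.sum_insert hv, hfilter, smul_add,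
      smul_smul, ← mul_pow, Finset.erase_insert hv, bdry_single, map_sum, Finset.smul_sum,
      add_assoc, ← Finset.sum_add_distrib, Finset.sum_eq_zero]
    · simp
    · intro w hw
      have hwv : w ≠ v := fun h => hv (h ▸ hw)
      have hnot : v ∉ σ.erase w := fun h => hv (Finset.mem_of_mem_erase h)
      rw [map_smul, coneOp_single, if_neg hnot, Finset.erase_insert_of_ne hwv.symm, smul_smul,
        smul_smul, ← add_smul]
      convert! zero_smul K _
      rcases lt_or_gt_of_ne hwv with h | h
      · have h1 : ((insert v σ).filter fun u => u < w) = σ.filter fun u => u < w := by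
          ext u; simp only [Finset.mem_filter, Finset.mem_insert]; grind
        have h2 : (σ.filter fun u => u < v) =
            insert w ((σ.erase w).filter fun u => u < v) := by
          ext u; simp only [Finset.mem_filter, Finset.mem_insert, Finset.mem_erase]; grind
        rw [h1, h2, Finset.card_insert_of_notMem (by simp)]
        ring
      · have h1 : ((insert v σ).filter fun u => u < w) =
            insert v (σ.filter fun u => u < w) := by
          ext u; simp only [Finset.mem_filter, Finset.mem_insert]; grind
        have h2 : ((σ.erase w).filter fun u => u < v) = σ.filter fun u => u < v := by
          ext u; simp only [Finset.mem_filter, Finset.mem_erase]; grind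
        rw [h1, h2, Finset.card_insert_of_notMem (by simp [hv])]
        ring

theorem bdry_coneOp_add (K : Type*) [Field K] {ι : Type*} [LinearOrder ι] (v : ι)
    (z : Finset ι →₀ K) : bdry K (coneOp K v z) + coneOp K v (bdry K z) = z := by
  have h : bdry K ∘ₗ coneOp K v + coneOp K v ∘ₗ bdry K = LinearMap.id := by
    refine Finsupp.lhom_ext' fun σ => LinearMap.ext_ring ?_
    simpa using bdry_coneOp_single_add K v σ
  exact LinearMap.congr_fun h z

theorem coneOp_mem_cardFaces (K : Type*) [Field K] {ι : Type*} [LinearOrder ι] {Δ : FaceSet ι}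
    {v : ι} (hv : ∀ F ∈ Δ, insert v F ∈ Δ) {d : ℕ} {z : Finset ι →₀ K}
    (hz : z ∈ cardFaces K Δ d) : coneOp K v z ∈ cardFaces K Δ (d + 1) := by
  have h : cardFaces K Δ d ≤ (cardFaces K Δ (d + 1)).comap (coneOp K v) := by
    rw [cardFaces, Submodule.span_le]
    rintro _ ⟨σ, hσ, hd, rfl⟩
    rw [SetLike.mem_coe, Submodule.mem_comap, coneOp_single]
    split_ifs with hvσ
    · exact zero_mem _
    · exact Submodule.smul_mem _ _ (Submodule.subset_span
        ⟨_, hv σ hσ, by rw [Finset.card_insert_of_notMem hvσ, hd], rfl⟩)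
  exact h hz

theorem not_hasNontrivialReducedHomology_of_cone (K : Type*) [Field K] {ι : Type*} [LinearOrder ι]
    {Δ : FaceSet ι} {v : ι} (hv : ∀ F ∈ Δ, insert v F ∈ Δ) (j : ℤ) :
    ¬ HasNontrivialReducedHomology K Δ j := by
  rintro ⟨d, -, z, hz, hbz, hnot⟩
  refine hnot ⟨coneOp K v z, coneOp_mem_cardFaces K hv hz, ?_⟩
  simpa [hbz] using bdry_coneOp_add K v z

theorem HasNontrivialReducedHomology.exists_face {K : Type*} [Field K] {ι : Type*} [LinearOrder ι]
    {Δ : FaceSet ι} {j : ℤ} (h : HasNontrivialReducedHomology K Δ j) :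
    ∃ σ ∈ Δ, (σ.card : ℤ) = j + 1 := by
  obtain ⟨d, hd, z, hz, -, hnot⟩ := h
  by_contra! hcon
  have hbot : cardFaces K Δ d = ⊥ := by
    rw [cardFaces, Submodule.span_eq_bot]
    rintro _ ⟨σ, hσ, rfl, rfl⟩
    exact absurd hd (hcon σ hσ)
  rw [hbot, Submodule.mem_bot] at hz
  exact hnot ⟨0, zero_mem _, by rw [map_zero, hz]⟩

section LocalCohomology

variable {K : Type*} [Field K] {ι : Type*} [Fintype ι] [LinearOrder ι]

theorem lcNonzero.exists_card {I : Ideal (MvPolynomial ι K)} {i : ℕ} {α : ι → ℤ}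
    (h : lcNonzero K I i α) :
    ∃ d ≤ Fintype.card ι, i = d + (negSupport α).card := by
  obtain ⟨σ, -, hσ⟩ := HasNontrivialReducedHomology.exists_face h
  exact ⟨σ.card, Finset.card_le_univ σ, by omega⟩

theorem lcNonzero.apply_lt {Δ : FaceSet ι} (hΔ : IsSimplicialComplex Δ) {n i : ℕ} {α : ι → ℤ}
    (h : lcNonzero K (symbolicPower (srIdeal K Δ) n) i α) (v : ι) : α v < n := by
  by_contra! hv
  refine not_hasNontrivialReducedHomology_of_cone K (v := v) (fun F hF => ?_) _ h
  rw [mem_degreeComplex_symbolicPower_iff hΔ] at hF ⊢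
  obtain ⟨hF0, H, hH, hsub, hlt⟩ := hF
  have hvH : v ∈ H := by
    by_contra hvH
    have := Finset.single_le_sum (f := fun i => (α i).toNat) (fun _ _ => Nat.zero_le _)
      (Finset.mem_compl.mpr hvH)
    grind
  refine ⟨fun i hi => ?_, H, hH, ?_, hlt⟩
  · rcases Finset.mem_insert.mp hi with rfl | hi
    · omega
    · exact hF0 i hi
  · rw [Finset.insert_union]
    exact Finset.insert_subset hvH hsub

theorem lcNonzero.smul {Δ : FaceSet ι} (hΔ : IsSimplicialComplex Δ) {n i : ℕ} {α : ι → ℤ}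
    (h : lcNonzero K (symbolicPower (srIdeal K Δ) (n + 1)) i α) {k : ℕ} (hk : 1 ≤ k) :
    lcNonzero K (symbolicPower (srIdeal K Δ) (k * n + 1)) i (fun j => k * α j) := by
  have hk' : (0 : ℤ) < k := by exact_mod_cast hk
  have hneg : negSupport (fun j => k * α j) = negSupport α := by
    ext j; simp [negSupport, mul_neg_iff, hk'.not_gt, Nat.pos_of_ne_zero (Nat.one_le_iff_ne_zero.mp hk)]
  have hnat (j : ι) : (k * α j).toNat = k * (α j).toNat := by
    rcases le_total 0 (α j) with hj | hj
    · rw [Int.toNat_mul (Int.natCast_nonneg k) hj, Int.toNat_natCast]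
    · rw [Int.toNat_of_nonpos hj, Int.toNat_of_nonpos (mul_nonpos_of_nonneg_of_nonpos hk'.le hj),
        mul_zero]
  have hcomplex : degreeComplex K (symbolicPower (srIdeal K Δ) (k * n + 1)) (fun j => k * α j) =
      degreeComplex K (symbolicPower (srIdeal K Δ) (n + 1)) α := by
    ext F
    rw [mem_degreeComplex_symbolicPower_iff hΔ, mem_degreeComplex_symbolicPower_iff hΔ, hneg]
    simp only [mul_nonneg_iff_of_pos_left hk', hnat, ← Finset.mul_sum,
      Nat.lt_succ_iff, Nat.mul_le_mul_left_iff hk]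
  rw [lcNonzero, hneg, hcomplex]
  exact h

theorem lcNonzero.max_neg_one {I : Ideal (MvPolynomial ι K)} {i : ℕ} {α : ι → ℤ}
    (h : lcNonzero K I i α) : lcNonzero K I i (fun j => max (α j) (-1)) := by
  have hneg : negSupport (fun j => max (α j) (-1)) = negSupport α := by
    ext j; simp [negSupport]
  have hnat (j : ι) : (max (α j) (-1)).toNat = (α j).toNat := by omega
  have hnonneg (j : ι) : 0 ≤ max (α j) (-1) ↔ 0 ≤ α j := by omega
  have hcomplex : degreeComplex K I (fun j => max (α j) (-1)) = degreeComplex K I α := by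
    simp only [degreeComplex, hneg, hnat, hnonneg]
  rw [lcNonzero, hneg, hcomplex]
  exact h

theorem sum_le_of_lcNonzero {Δ : FaceSet ι} (hΔ : IsSimplicialComplex Δ) {n i : ℕ} {α : ι → ℤ}
    (h : lcNonzero K (symbolicPower (srIdeal K Δ) (n + 1)) i α) :
    ∑ j, α j ≤ Fintype.card ι * n := by
  have := Finset.sum_le_card_nsmul Finset.univ α n fun j _ => by
    have := h.apply_lt hΔ j
    push_cast at this
    omega
  simpa using this

theorem add_le_regQuot_of_lcNonzero {Δ : FaceSet ι} (hΔ : IsSimplicialComplex Δ) {n i : ℕ}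
    {α : ι → ℤ} (h : lcNonzero K (symbolicPower (srIdeal K Δ) (n + 1)) i α) :
    ∑ j, α j + i ≤ regQuot K (symbolicPower (srIdeal K Δ) (n + 1)) := by
  refine le_csSup ⟨(Fintype.card ι * n + 2 * Fintype.card ι : ℤ), ?_⟩ ⟨i, α, h, rfl⟩
  rintro _ ⟨i', β, hβ, rfl⟩
  obtain ⟨d, hd, hi⟩ := hβ.exists_card
  have h1 := sum_le_of_lcNonzero hΔ hβ
  have h2 := Finset.card_le_univ (negSupport β)
  omega

theorem regQuot_symbolicPower_nonneg {Δ : FaceSet ι} (hΔ : IsSimplicialComplex Δ) (n : ℕ) :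
    0 ≤ regQuot K (symbolicPower (srIdeal K Δ) (n + 1)) := by
  by_cases hex : ∃ (i : ℕ) (α : ι → ℤ), lcNonzero K (symbolicPower (srIdeal K Δ) (n + 1)) i α
  · obtain ⟨i, α, h⟩ := hex
    obtain ⟨d, -, hi⟩ := h.exists_card
    refine le_trans ?_ (add_le_regQuot_of_lcNonzero hΔ h.max_neg_one)
    have hsum : ∑ j, (if α j < 0 then (-1 : ℤ) else 0) ≤ ∑ j, max (α j) (-1) :=
      Finset.sum_le_sum fun j _ => by split_ifs <;> omega
    have hcard : ∑ j, (if α j < 0 then (-1 : ℤ) else 0) = -(negSupport α).card := by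
      simp [negSupport, ← Finset.sum_filter]
    omega
  · have hempty : {z : ℤ | ∃ (i : ℕ) (α : ι → ℤ),
        lcNonzero K (symbolicPower (srIdeal K Δ) (n + 1)) i α ∧ z = (∑ j, α j) + i} = ∅ := by
      ext z
      simp only [Set.mem_ofPred_eq, Set.mem_empty_iff_false, iff_false]
      rintro ⟨i, α, h, -⟩
      exact hex ⟨i, α, h⟩
    rw [regQuot, hempty, Int.csSup_empty]

theorem nonneg_of_tendsto_reg {Δ : FaceSet ι} (hΔ : IsSimplicialComplex Δ) {δ : ℝ}
    (hδ : Tendsto (fun n : ℕ => (reg K (symbolicPower (srIdeal K Δ) n) : ℝ) / n) atTop (nhds δ)) :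
    0 ≤ δ := by
  refine ge_of_tendsto hδ ((eventually_ge_atTop 1).mono fun n hn => ?_)
  obtain ⟨m, rfl⟩ := Nat.exists_eq_add_of_le' hn
  have h := regQuot_symbolicPower_nonneg (K := K) hΔ m
  have h' : (0 : ℝ) ≤ reg K (symbolicPower (srIdeal K Δ) (m + 1)) := by
    rw [reg]
    exact_mod_cast h.trans (Int.le_add_one le_rfl)
  positivity

theorem sum_le_mul_of_tendsto_reg {Δ : FaceSet ι} (hΔ : IsSimplicialComplex Δ) {δ : ℝ}
    (hδ : Tendsto (fun n : ℕ => (reg K (symbolicPower (srIdeal K Δ) n) : ℝ) / n) atTop (nhds δ))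
    {n i : ℕ} {α : ι → ℤ} (h : lcNonzero K (symbolicPower (srIdeal K Δ) (n + 1)) i α) :
    ((∑ j, α j : ℤ) : ℝ) ≤ δ * n := by
  rcases Nat.eq_zero_or_pos n with rfl | hn
  · have := sum_le_of_lcNonzero hΔ h
    have h0 : ∑ j, α j ≤ 0 := by simpa using this
    have h1 : ((∑ j, α j : ℤ) : ℝ) ≤ 0 := by exact_mod_cast h0
    simpa using h1
  · have hn' : (0 : ℝ) < n := by exact_mod_cast hn
    have hm : Tendsto (fun k : ℕ => k * n + 1) atTop atTop :=
      tendsto_atTop_mono (fun k => (Nat.le_mul_of_pos_right k hn).trans (Nat.le_succ _)) tendsto_id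
    have hlim : Tendsto (fun k : ℕ => (k : ℝ) / (k * n + 1)) atTop (nhds (1 / n)) := by
      have h1 : Tendsto (fun k : ℕ => 1 / ((n : ℝ) + 1 / (k : ℝ))) atTop (nhds (1 / (n + 0))) :=
        tendsto_const_nhds.div (tendsto_const_nhds.add tendsto_one_div_atTop_nhds_zero_nat)
          (by simpa using hn'.ne')
      rw [add_zero] at h1
      refine h1.congr' ((eventually_ge_atTop 1).mono fun k hk => ?_)
      have hk' : (0 : ℝ) < k := by exact_mod_cast hk
      field_simp
    have hle := le_of_tendsto_of_tendsto (hlim.const_mul ((∑ j, α j : ℤ) : ℝ)) (hδ.comp hm)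
      ((eventually_ge_atTop 1).mono fun k hk => ?_)
    · rwa [mul_one_div, div_le_iff₀ hn'] at hle
    · have hreg := add_le_regQuot_of_lcNonzero hΔ (h.smul hΔ hk)
      rw [← Finset.mul_sum] at hreg
      have hreg' : (k : ℤ) * ∑ j, α j ≤ reg K (symbolicPower (srIdeal K Δ) (k * n + 1)) := by
        rw [reg]; omega
      have hreg'' : (k : ℝ) * (∑ j, α j : ℤ) ≤
          reg K (symbolicPower (srIdeal K Δ) (k * n + 1)) := by exact_mod_cast hreg'
      simp only [Function.comp_apply]
      rw [← mul_div_assoc, mul_comm]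
      push_cast at hreg'' ⊢
      gcongr

end LocalCohomology

/-- For a square-free monomial ideal `I` of `R = K[x_1, …, x_r]`,
every integer `n ≥ 1` and every `i ≥ 0`: `a_i(R/I^{(n)}) ≤ δ(I)·(n − 1)`, where
`δ(I) = lim_n reg(I^{(n)})/n`. -/
theorem statement0 {K : Type*} [Field K] {r : ℕ}
    (I : Ideal (MvPolynomial (Fin r) K))
    (hI : ∃ Δ : FaceSet (Fin r), IsSimplicialComplex Δ ∧ I = srIdeal K Δ)
    (δ : ℝ)
    (hδ : Filter.Tendsto (fun n : ℕ => (reg K (symbolicPower I n) : ℝ) / n)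
      Filter.atTop (nhds δ))
    (n : ℕ) (hn : 1 ≤ n) (i : ℕ) :
    (aInv K (symbolicPower I n) i : ℝ) ≤ δ * (n - 1) := by
  obtain ⟨Δ, hΔ, rfl⟩ := hI
  obtain ⟨m, rfl⟩ := Nat.exists_eq_add_of_le' hn
  have hcast : ((m + 1 : ℕ) : ℝ) - 1 = m := by push_cast; ring
  rw [hcast, aInv]
  set S := {z : ℤ | ∃ α : Fin r → ℤ,
    lcNonzero K (symbolicPower (srIdeal K Δ) (m + 1)) i α ∧ z = ∑ j, α j}
  rcases S.eq_empty_or_nonempty with hempty | hne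
  · rw [hempty, Int.csSup_empty, Int.cast_zero]
    exact mul_nonneg (nonneg_of_tendsto_reg hΔ hδ) m.cast_nonneg
  · have hbdd : BddAbove S := by
      refine ⟨(Fintype.card (Fin r) * m : ℤ), ?_⟩
      rintro _ ⟨α, hα, rfl⟩
      exact sum_le_of_lcNonzero hΔ hα
    obtain ⟨α, hα, hsum⟩ := Int.csSup_mem hne hbdd
    rw [hsum]
    exact sum_le_mul_of_tendsto_reg hΔ hδ hα
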